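/- arXiv:1306.3549 — 7 statements merged into one kernel-verified Lean document; each statement's English description precedes it below -/
import Mathlib

section
/- Let f : ℝ → ℝ be given by f(x) = 1 + x², and let u : ℝ → ℝ be four times continuously differentiable. Then u is f-biharmonic, i.e. ((1+x²)·u'')'' = 0 identically on ℝ, if and only if there exist constants A, B, C, D ∈ ℝ such that u(x) = (1/2)(Ax − B)·ln(1 + x²) + (Bx + A)·arctan x + (C − A)·x + D for all x ∈ ℝ. -/
/-- Two antiderivatives of the same function on `ℝ` differ by a constant. -/
theorem exists_eq_add_const_of_hasDerivAt {g h k : ℝ → ℝ}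
    (hg : ∀ x, HasDerivAt g (k x) x) (hh : ∀ x, HasDerivAt h (k x) x) :
    ∃ c, ∀ x, g x = h x + c := by
  have hd : ∀ x, HasDerivAt (fun y => g y - h y) 0 x := fun x => by
    simpa using (hg x).fun_sub (hh x)
  refine ⟨g 0 - h 0, fun x => ?_⟩
  have := is_const_of_deriv_eq_zero (fun y => (hd y).differentiableAt) (fun y => (hd y).deriv) x 0
  linarith

theorem hasDerivAt_log_one_add_sq (x : ℝ) :
    HasDerivAt (fun y : ℝ => Real.log (1 + y ^ 2)) (2 * x / (1 + x ^ 2)) x := by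
  have h : HasDerivAt (fun y : ℝ => 1 + y ^ 2) (2 * x) x := by
    simpa using (hasDerivAt_pow 2 x).const_add 1
  exact h.log (by positivity)

theorem hasDerivAt_log_add_arctan (A B C x : ℝ) :
    HasDerivAt (fun y : ℝ => (1 / 2) * A * Real.log (1 + y ^ 2) + B * Real.arctan y + C)
      ((A * x + B) / (1 + x ^ 2)) x := by
  have h := (((hasDerivAt_log_one_add_sq x).const_mul ((1 / 2) * A)).fun_add
    ((Real.hasDerivAt_arctan x).const_mul B)).add_const C
  refine h.congr_deriv ?_
  field_simp

theorem hasDerivAt_biharmonic_solution (A B C D x : ℝ) :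
    HasDerivAt (fun y : ℝ => (1 / 2) * (A * y - B) * Real.log (1 + y ^ 2)
        + (B * y + A) * Real.arctan y + (C - A) * y + D)
      ((1 / 2) * A * Real.log (1 + x ^ 2) + B * Real.arctan x + C) x := by
  have hA : HasDerivAt (fun y : ℝ => (1 / 2) * (A * y - B)) ((1 / 2) * (A * 1)) x :=
    (((hasDerivAt_id' x).const_mul A).sub_const B).const_mul (1 / 2)
  have hB : HasDerivAt (fun y : ℝ => B * y + A) (B * 1) x :=
    ((hasDerivAt_id' x).const_mul B).add_const A
  have h := (((hA.fun_mul (hasDerivAt_log_one_add_sq x)).fun_add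
    (hB.fun_mul (Real.hasDerivAt_arctan x))).fun_add
    ((hasDerivAt_id' x).const_mul (C - A))).add_const D
  refine h.congr_deriv ?_
  field_simp
  ring


/-- For `f(x) = 1 + x²` and `u : ℝ → ℝ` of class `C⁴`, `u` is `f`-biharmonic
(i.e. `((1+x²)·u'')'' = 0` identically) if and only if
`u(x) = (1/2)(Ax − B)·ln(1 + x²) + (Bx + A)·arctan x + (C − A)·x + D` for some constants. -/
theorem stmt_3 (u : ℝ → ℝ) (hu : ContDiff ℝ 4 u) :
    (∀ x : ℝ, deriv (deriv (fun y => (1 + y ^ 2) * deriv (deriv u) y)) x = 0)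
      ↔ ∃ A B C D : ℝ, ∀ x : ℝ,
          u x = (1 / 2) * (A * x - B) * Real.log (1 + x ^ 2)
            + (B * x + A) * Real.arctan x + (C - A) * x + D := by
 
  constructor
  · intro h
    have hu1 : ContDiff ℝ 3 (deriv u) :=
      ((contDiff_succ_iff_deriv (n := 3)).1 (hu.of_le (by norm_num))).2.2
    have hu2 : ContDiff ℝ 2 (deriv (deriv u)) :=
      ((contDiff_succ_iff_deriv (n := 2)).1 (hu1.of_le (by norm_num))).2.2
    have hw : ContDiff ℝ 2 (fun y => (1 + y ^ 2) * deriv (deriv u) y) := by fun_prop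
    have hw1 : ContDiff ℝ 1 (deriv fun y => (1 + y ^ 2) * deriv (deriv u) y) :=
      ((contDiff_succ_iff_deriv (n := 1)).1 (hw.of_le (by norm_num))).2.2
    have hconst := is_const_of_deriv_eq_zero (hw1.differentiable (by norm_num)) h
    set A := deriv (fun y => (1 + y ^ 2) * deriv (deriv u) y) 0 with hA
    obtain ⟨B, hB⟩ := exists_eq_add_const_of_hasDerivAt
      (g := fun y => (1 + y ^ 2) * deriv (deriv u) y) (h := fun y => A * y) (k := fun _ => A)
      (fun x => by
        rw [hA, ← hconst x 0]
        exact (hw.differentiable (by norm_num) x).hasDerivAt)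
      (fun x => by simpa using (hasDerivAt_id' x).const_mul A)
    have hu'' : ∀ x, deriv (deriv u) x = (A * x + B) / (1 + x ^ 2) := fun x => by
      rw [eq_div_iff (by positivity), ← hB x, mul_comm]
    obtain ⟨C, hC⟩ := exists_eq_add_const_of_hasDerivAt
      (fun x => by
        rw [← hu'' x]
        exact (hu1.differentiable (by norm_num) x).hasDerivAt)
      (hasDerivAt_log_add_arctan A B 0)
    obtain ⟨D, hD⟩ := exists_eq_add_const_of_hasDerivAt
      (fun x => by
        have := (hu.differentiable (by norm_num) x).hasDerivAt
        rwa [hC x, add_zero] at this)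
      (hasDerivAt_biharmonic_solution A B C 0)
    exact ⟨A, B, C, D, fun x => by rw [hD x, add_zero]⟩
  · rintro ⟨A, B, C, D, h⟩ x
    have h1 : deriv u = fun y => (1 / 2) * A * Real.log (1 + y ^ 2) + B * Real.arctan y + C := by
      rw [funext h]
      exact funext fun y => (hasDerivAt_biharmonic_solution A B C D y).deriv
    have h2 : (fun y => (1 + y ^ 2) * deriv (deriv u) y) = fun y => A * y + B := by
      funext y
      rw [h1, (hasDerivAt_log_add_arctan A B C y).deriv]
      field_simp
    have h3 : deriv (fun y : ℝ => A * y + B) = fun _ => A := by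
      funext y
      simp
    rw [h2, h3, deriv_const]
end

section
/- Let f : ℝ → ℝ be given by f(x) = e^{−x}, and let u : ℝ → ℝ be four times continuously differentiable. Then u is f-biharmonic, i.e. (e^{−x}·u'')'' = 0 identically on ℝ, if and only if there exist constants A, B, C, D ∈ ℝ such that u(x) = (Ax − 2A + B)·e^x + Cx + D for all x ∈ ℝ. -/
theorem exists_affine_of_deriv_deriv_eq_zero {g : ℝ → ℝ} (hg : ContDiff ℝ 2 g)
    (h : ∀ x, deriv (deriv g) x = 0) : ∃ a b : ℝ, ∀ x, g x = a * x + b := by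
  have hg' : Differentiable ℝ (deriv g) :=
    (ContDiff.deriv' (n := 1) (by simpa [one_add_one_eq_two] using hg)).differentiable one_ne_zero
  have hconst : ∀ x, deriv g x = deriv g 0 := fun x => is_const_of_deriv_eq_zero hg' h x 0
  have hlin : ∀ x, HasDerivAt (fun y => g y - deriv g 0 * y) 0 x := fun x => by
    have h₁ := (hg.differentiable two_ne_zero x).hasDerivAt.sub
      ((hasDerivAt_id x).const_mul (deriv g 0))
    exact h₁.congr_deriv (by simp [hconst x])
  refine ⟨deriv g 0, g 0, fun x => ?_⟩
  have h₀ := is_const_of_deriv_eq_zero (fun y => (hlin y).differentiableAt)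
    (fun y => (hlin y).deriv) x 0
  simp only [mul_zero, sub_zero] at h₀
  linarith

theorem hasDerivAt_affine_mul_exp (a b c d x : ℝ) :
    HasDerivAt (fun y => (a * y + b) * Real.exp y + c * y + d)
      ((a * x + (a + b)) * Real.exp x + c) x := by
  have h := (((((hasDerivAt_id x).const_mul a).add_const b).mul (Real.hasDerivAt_exp x)).add
    ((hasDerivAt_id x).const_mul c)).add_const d
  refine h.congr_deriv ?_
  simp only [id]
  ring

theorem deriv_deriv_affine_mul_exp (a b c d : ℝ) :
    deriv (deriv fun y => (a * y + b) * Real.exp y + c * y + d) =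
      fun x => (a * x + (2 * a + b)) * Real.exp x := by
  have h₁ : deriv (fun y => (a * y + b) * Real.exp y + c * y + d) =
      fun x => (a * x + (a + b)) * Real.exp x + 0 * x + c :=
    funext fun x => by rw [(hasDerivAt_affine_mul_exp a b c d x).deriv]; ring
  rw [h₁]
  funext x
  rw [(hasDerivAt_affine_mul_exp a (a + b) 0 c x).deriv]
  ring

/-- For `f(x) = e^{−x}` and `u : ℝ → ℝ` of class `C⁴`, `u` is `f`-biharmonic
(i.e. `(e^{−x}·u'')'' = 0` identically) if and only if
`u(x) = (Ax − 2A + B)·e^x + Cx + D` for some constants `A, B, C, D`. -/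
theorem stmt_4 (u : ℝ → ℝ) (hu : ContDiff ℝ 4 u) :
    (∀ x : ℝ, deriv (deriv (fun y => Real.exp (-y) * deriv (deriv u) y)) x = 0)
      ↔ ∃ A B C D : ℝ, ∀ x : ℝ,
          u x = (A * x - 2 * A + B) * Real.exp x + C * x + D := by
  constructor
  · intro h
    have hu₁ : ContDiff ℝ 3 (deriv u) := ContDiff.deriv' (by norm_num; exact hu)
    have hu₂ : ContDiff ℝ 2 (deriv (deriv u)) := ContDiff.deriv' (by norm_num; exact hu₁)
    obtain ⟨A, B, hAB⟩ := exists_affine_of_deriv_deriv_eq_zero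
      ((Real.contDiff_exp.comp contDiff_neg).mul hu₂) h
    have hdd : ∀ x, deriv (deriv u) x = (A * x + B) * Real.exp x := fun x => by
      have hx := hAB x
      simp only [Function.comp_apply] at hx
      rw [← hx, mul_right_comm, ← Real.exp_add]
      simp
    let v : ℝ → ℝ := fun y => (A * y + (B - 2 * A)) * Real.exp y + 0 * y + 0
    have hv : ContDiff ℝ 2 v := by
      unfold v
      fun_prop
    have hv₁ : Differentiable ℝ (deriv v) :=
      (ContDiff.deriv' (n := 1) (by simpa [one_add_one_eq_two] using hv)).differentiable
        one_ne_zero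
    have hw : deriv (u - v) = deriv u - deriv v := funext fun x =>
      deriv_sub (hu.differentiable (by norm_num) x) (hv.differentiable two_ne_zero x)
    obtain ⟨C, D, hCD⟩ := exists_affine_of_deriv_deriv_eq_zero (g := u - v)
      ((hu.of_le (by norm_num)).sub hv) fun x => by
        rw [hw, deriv_sub (hu₁.differentiable (by norm_num) x) (hv₁ x), hdd,
          deriv_deriv_affine_mul_exp]
        ring
    refine ⟨A, B, C, D, fun x => ?_⟩
    have hx := hCD x
    simp only [Pi.sub_apply, v] at hx
    linear_combination hx
  · rintro ⟨A, B, C, D, h⟩ x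
    have hu' : u = fun y => (A * y + (B - 2 * A)) * Real.exp y + C * y + D :=
      funext fun y => by rw [h]; ring
    have hf : (fun y => Real.exp (-y) * deriv (deriv u) y) = fun y => A * y + B :=
      funext fun y => by
        rw [hu', deriv_deriv_affine_mul_exp]
        have hexp : Real.exp (-y) * Real.exp y = 1 := by
          rw [← Real.exp_add, neg_add_cancel, Real.exp_zero]
        linear_combination (A * y + B) * hexp
    have hd : deriv (fun y => A * y + B) = fun _ => A := funext fun y => by
      simp
    rw [hf, hd, deriv_const]
end

section
/- Let A, B, C, D ∈ ℝ with A ≠ 0, and let u : ℝ → ℝ be given by u(x) = (Ax − 2A + B)·e^x + Cx + D. Then u''(x) = (Ax + B)·e^x and u''''(x) = (Ax + 2A + B)·e^x for all x ∈ ℝ; in particular u'' is not identically zero and u'''' is not identically zero, so u is neither a harmonic function nor a biharmonic function on ℝ (while it is f-biharmonic for f(x) = e^{−x}). -/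
theorem deriv_affine_mul_exp_add_affine (a b c d : ℝ) :
    deriv (fun x : ℝ => (a * x + b) * Real.exp x + (c * x + d)) =
      fun x => (a * x + (a + b)) * Real.exp x + (0 * x + c) := by
  funext x
  have hlin (p q : ℝ) : HasDerivAt (fun x : ℝ => p * x + q) p x := by
    simpa using ((hasDerivAt_id x).const_mul p).add_const q
  refine (((hlin a b).mul (Real.hasDerivAt_exp x)).add (hlin c d)).deriv.trans ?_
  ring

theorem not_forall_affine_mul_exp_eq_zero {a : ℝ} (ha : a ≠ 0) (b : ℝ) :
    ¬ ∀ x : ℝ, (a * x + b) * Real.exp x = 0 := by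
  intro h
  have hlin (x : ℝ) : a * x + b = 0 := (mul_eq_zero.mp (h x)).resolve_right (Real.exp_ne_zero x)
  exact ha (by linarith [hlin 0, hlin 1])

/-- For `A ≠ 0` and `u(x) = (Ax − 2A + B)·e^x + Cx + D`: one has `u''(x) = (Ax + B)·e^x`
and `u''''(x) = (Ax + 2A + B)·e^x`; in particular `u''` and `u''''` are not identically zero
(so `u` is neither harmonic nor biharmonic), while `u` is `f`-biharmonic for `f(x) = e^{−x}`,
i.e. `(e^{−x}·u'')'' = 0` identically. -/
theorem stmt_5 (A B C D : ℝ) (hA : A ≠ 0)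
    (u : ℝ → ℝ) (hu : u = fun x => (A * x - 2 * A + B) * Real.exp x + C * x + D) :
    (∀ x : ℝ, deriv (deriv u) x = (A * x + B) * Real.exp x) ∧
    (∀ x : ℝ, deriv (deriv (deriv (deriv u))) x = (A * x + 2 * A + B) * Real.exp x) ∧
    ¬ (∀ x : ℝ, deriv (deriv u) x = 0) ∧
    ¬ (∀ x : ℝ, deriv (deriv (deriv (deriv u))) x = 0) ∧
    (∀ x : ℝ, deriv (deriv (fun y => Real.exp (-y) * deriv (deriv u) y)) x = 0) := by
  have hu' : u = fun x => (A * x + (B - 2 * A)) * Real.exp x + (C * x + D) := by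
    rw [hu]
    funext x
    ring
  have h2 (x : ℝ) : deriv (deriv u) x = (A * x + B) * Real.exp x := by
    simp only [hu', deriv_affine_mul_exp_add_affine]
    ring
  have h4 (x : ℝ) :
      deriv (deriv (deriv (deriv u))) x = (A * x + 2 * A + B) * Real.exp x := by
    simp only [hu', deriv_affine_mul_exp_add_affine]
    ring
  refine ⟨h2, h4, ?_, ?_, fun x => ?_⟩
  · simpa only [h2] using not_forall_affine_mul_exp_eq_zero hA B
  · simpa only [h4, add_assoc] using not_forall_affine_mul_exp_eq_zero hA (2 * A + B)
  · have hf : (fun y => Real.exp (-y) * deriv (deriv u) y) =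
        fun y => (0 * y + 0) * Real.exp y + (A * y + B) := by
      funext y
      rw [h2, mul_left_comm, ← Real.exp_add]
      simp
    simp [hf]
end

section
/- Let m ≥ 1 be an integer, let 1 ≤ i ≤ m, let p, k ∈ ℝ, and let u : ℝ^m ∖ {0} → ℝ be given by u(x) = x_i·|x|^{−p}. Then for every x ∈ ℝ^m ∖ {0}, Δ(|x|^k · Δu)(x) = p(p − m)(k − p − 2)(k − p + m − 2)·x_i·|x|^{k−p−4}. -/
/-- The Euclidean Laplacian `Δu = ∑ i ∂²u/∂x_i²` of a function on `ℝ^m`. -/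
noncomputable def eLaplacian {m : ℕ} (u : EuclideanSpace ℝ (Fin m) → ℝ)
    (x : EuclideanSpace ℝ (Fin m)) : ℝ :=
  ∑ i : Fin m,
    fderiv ℝ (fun y => fderiv ℝ u y (EuclideanSpace.single i 1)) x (EuclideanSpace.single i 1)

/-- The derivative of `‖·‖ ^ q` away from the origin, for an arbitrary real exponent. -/
theorem hasFDerivAt_norm_rpow_of_ne_zero {E : Type*} [NormedAddCommGroup E]
    [InnerProductSpace ℝ E] (q : ℝ) {x : E} (hx : x ≠ 0) :
    HasFDerivAt (fun y : E => ‖y‖ ^ q) ((q * ‖x‖ ^ (q - 2)) • innerSL ℝ x) x := by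
  have hpos : 0 < ‖x‖ := norm_pos_iff.mpr hx
  have hsq : HasFDerivAt (fun y : E => ‖y‖ ^ 2) (2 • innerSL ℝ x) x :=
    (hasStrictFDerivAt_norm_sq x).hasFDerivAt
  have hpow := hsq.rpow_const (p := q / 2) (Or.inl (by positivity))
  have heq : ∀ (y : E) (s : ℝ), (‖y‖ ^ 2) ^ (s / 2) = ‖y‖ ^ s := fun y s => by
    rw [← Real.rpow_natCast, ← Real.rpow_mul (norm_nonneg y)]
    congr 1
    push_cast
    ring
  simp only [heq, show q / 2 - 1 = (q - 2) / 2 by ring] at hpow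
  refine hpow.congr_fderiv ?_
  ext v
  simp
  ring

theorem EuclideanSpace.hasFDerivAt_apply {m : ℕ} (i : Fin m) (x : EuclideanSpace ℝ (Fin m)) :
    HasFDerivAt (fun y : EuclideanSpace ℝ (Fin m) => y i)
      (EuclideanSpace.proj i : EuclideanSpace ℝ (Fin m) →L[ℝ] ℝ) x :=
  (EuclideanSpace.proj i : EuclideanSpace ℝ (Fin m) →L[ℝ] ℝ).hasFDerivAt

theorem fderiv_const_mul_coord_mul_norm_rpow {m : ℕ} (i j : Fin m) (c q : ℝ)
    {x : EuclideanSpace ℝ (Fin m)} (hx : x ≠ 0) :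
    fderiv ℝ (fun y : EuclideanSpace ℝ (Fin m) => c * (y i * ‖y‖ ^ q)) x
        (EuclideanSpace.single j 1)
      = c * ((if i = j then 1 else 0) * ‖x‖ ^ q + q * (x i * x j * ‖x‖ ^ (q - 2))) := by
  rw [(((EuclideanSpace.hasFDerivAt_apply i x).fun_mul
    (hasFDerivAt_norm_rpow_of_ne_zero q hx)).const_mul c).fderiv]
  by_cases hij : i = j <;>
    simp [EuclideanSpace.inner_single_right, hij, -mul_eq_mul_left_iff] <;> ring

theorem fderiv_fderiv_const_mul_coord_mul_norm_rpow {m : ℕ} (i j : Fin m) (c q : ℝ)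
    {x : EuclideanSpace ℝ (Fin m)} (hx : x ≠ 0) :
    fderiv ℝ (fun z => fderiv ℝ (fun y : EuclideanSpace ℝ (Fin m) => c * (y i * ‖y‖ ^ q)) z
        (EuclideanSpace.single j 1)) x (EuclideanSpace.single j 1)
      = c * q * (2 * (if i = j then x j else 0) * ‖x‖ ^ (q - 2) + x i * ‖x‖ ^ (q - 2)
          + (q - 2) * x i * x j ^ 2 * ‖x‖ ^ (q - 4)) := by
  have hev : (fun z => fderiv ℝ (fun y : EuclideanSpace ℝ (Fin m) => c * (y i * ‖y‖ ^ q)) z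
        (EuclideanSpace.single j 1)) =ᶠ[nhds x] fun z =>
      c * ((if i = j then 1 else 0) * ‖z‖ ^ q + q * (z i * z j * ‖z‖ ^ (q - 2))) := by
    filter_upwards [isOpen_ne.mem_nhds hx] with z hz
    exact fderiv_const_mul_coord_mul_norm_rpow i j c q hz
  rw [hev.fderiv_eq, ((((hasFDerivAt_norm_rpow_of_ne_zero q hx).const_mul (if i = j then 1 else 0)).fun_add
    ((((EuclideanSpace.hasFDerivAt_apply i x).fun_mul (EuclideanSpace.hasFDerivAt_apply j x)).fun_mul
      (hasFDerivAt_norm_rpow_of_ne_zero (q - 2) hx)).const_mul q)).const_mul c).fderiv]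
  have h4 : q - 2 - 2 = q - 4 := by ring
  by_cases hij : i = j
  · subst hij
    simp [EuclideanSpace.inner_single_right, h4]
    ring
  · simp [EuclideanSpace.inner_single_right, hij, h4]
    ring

/-- `Δ(c·x_i·|x|^q) = c·q·(q + m)·x_i·|x|^{q−2}` away from the origin. -/
theorem eLaplacian_const_mul_coord_mul_norm_rpow {m : ℕ} (i : Fin m) (c q : ℝ)
    {x : EuclideanSpace ℝ (Fin m)} (hx : x ≠ 0) :
    eLaplacian (fun y => c * (y i * ‖y‖ ^ q)) x
      = c * q * (q + m) * (x i * ‖x‖ ^ (q - 2)) := by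
  have hpos : 0 < ‖x‖ := norm_pos_iff.mpr hx
  have hnorm : ∑ j, x j ^ 2 = ‖x‖ ^ 2 := by
    rw [EuclideanSpace.norm_sq_eq]
    simp
  have hpow : ‖x‖ ^ (q - 2) = ‖x‖ ^ 2 * ‖x‖ ^ (q - 4) := by
    rw [← Real.rpow_natCast, ← Real.rpow_add hpos]
    congr 1
    push_cast
    ring
  simp only [eLaplacian, fderiv_fderiv_const_mul_coord_mul_norm_rpow i _ c q hx]
  rw [← Finset.mul_sum, Finset.sum_add_distrib, Finset.sum_add_distrib, ← Finset.sum_mul,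
    ← Finset.mul_sum, ← Finset.sum_mul, ← Finset.sum_mul, ← Finset.mul_sum, hnorm]
  simp only [Finset.sum_ite_eq, Finset.mem_univ, if_true, Finset.sum_const, Finset.card_univ,
    Fintype.card_fin, nsmul_eq_mul, hpow]
  ring

theorem Filter.EventuallyEq.eLaplacian_eq {m : ℕ} {u v : EuclideanSpace ℝ (Fin m) → ℝ}
    {x : EuclideanSpace ℝ (Fin m)} (h : u =ᶠ[nhds x] v) : eLaplacian u x = eLaplacian v x := by
  refine Finset.sum_congr rfl fun j _ => ?_
  have hj : (fun y => fderiv ℝ u y (EuclideanSpace.single j 1)) =ᶠ[nhds x]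
      fun y => fderiv ℝ v y (EuclideanSpace.single j 1) := by
    filter_upwards [h.fderiv (𝕜 := ℝ)] with y hy
    rw [hy]
  rw [hj.fderiv_eq]

/-- For `u(x) = x_i·|x|^{−p}` on `ℝ^m ∖ {0}`,
`Δ(|x|^k·Δu)(x) = p(p − m)(k − p − 2)(k − p + m − 2)·x_i·|x|^{k−p−4}`. -/
theorem stmt_7 (m : ℕ) (hm : 1 ≤ m) (i : Fin m) (p k : ℝ)
    (u : EuclideanSpace ℝ (Fin m) → ℝ) (hu : u = fun x => x i * ‖x‖ ^ (-p)) :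
    ∀ x : EuclideanSpace ℝ (Fin m), x ≠ 0 →
      eLaplacian (fun y => ‖y‖ ^ k * eLaplacian u y) x
        = p * (p - (m : ℝ)) * (k - p - 2) * (k - p + (m : ℝ) - 2) * x i * ‖x‖ ^ (k - p - 4) := by
  intro x hx
  have hev : (fun y => ‖y‖ ^ k * eLaplacian u y) =ᶠ[nhds x]
      fun y => (p * (p - m)) * (y i * ‖y‖ ^ (k - p - 2)) := by
    filter_upwards [isOpen_ne.mem_nhds hx] with y hy
    have h := eLaplacian_const_mul_coord_mul_norm_rpow i 1 (-p) hy
    simp only [one_mul] at h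
    rw [hu, h, show k - p - 2 = k + (-p - 2) by ring, Real.rpow_add (norm_pos_iff.mpr hy)]
    ring
  rw [hev.eLaplacian_eq, eLaplacian_const_mul_coord_mul_norm_rpow i _ _ hx,
    show k - p - 2 - 2 = k - p - 4 by ring]
  ring
end

section
/- Let a < b and let κ : (a, b) → ℝ be a twice continuously differentiable function with κ(s) > 0 for all s ∈ (a, b). Then κ satisfies the ordinary differential equation 3(κ'(s))² − 2κ(s)·κ''(s) = 4(κ(s))⁴ for all s ∈ (a, b) if and only if there exist constants c₂ > 0 and c₃ ∈ ℝ such that κ(s) = 4c₂/(16 + (c₂·s + c₃)²) for all s ∈ (a, b). -/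
open Set

theorem hasDerivAt_curvature_profile {c d : ℝ} (s : ℝ) :
    HasDerivAt (fun t => 4 * c / (16 + (c * t + d) ^ 2))
      (-(8 * c ^ 2 * (c * s + d)) / (16 + (c * s + d) ^ 2) ^ 2) s := by
  have hu : HasDerivAt (fun t => c * t + d) c s := by
    simpa using ((hasDerivAt_id s).const_mul c).add_const d
  have hD : 16 + (c * s + d) ^ 2 ≠ 0 := by positivity
  refine ((hasDerivAt_const s (4 * c)).fun_div ((hu.fun_pow 2).const_add 16) hD).congr_deriv ?_
  field_simp
  ring

theorem hasDerivAt_deriv_curvature_profile {c d : ℝ} (s : ℝ) :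
    HasDerivAt (fun t => -(8 * c ^ 2 * (c * t + d)) / (16 + (c * t + d) ^ 2) ^ 2)
      (8 * c ^ 3 * (3 * (c * s + d) ^ 2 - 16) / (16 + (c * s + d) ^ 2) ^ 3) s := by
  have hu : HasDerivAt (fun t => c * t + d) c s := by
    simpa using ((hasDerivAt_id s).const_mul c).add_const d
  have hD : 16 + (c * s + d) ^ 2 ≠ 0 := by positivity
  refine ((hu.const_mul (8 * c ^ 2)).fun_neg.fun_div (((hu.fun_pow 2).const_add 16).fun_pow 2)
    (pow_ne_zero 2 hD)).congr_deriv ?_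
  field_simp
  ring

theorem exists_eq_const_of_hasDerivAt_zero {a b : ℝ} (f : ℝ → ℝ)
    (hf : ∀ s ∈ Ioo a b, HasDerivAt f 0 s) : ∃ C, ∀ s ∈ Ioo a b, f s = C :=
  isOpen_Ioo.exists_is_const_of_deriv_eq_zero isPreconnected_Ioo
    (fun s hs => (hf s hs).differentiableAt.differentiableWithinAt) (fun s hs => (hf s hs).deriv)

/-- A positive `C²` function `κ` on `(a, b)` satisfies `3κ'² − 2κκ'' = 4κ⁴` if and only if
`κ(s) = 4c₂/(16 + (c₂s + c₃)²)` for some constants `c₂ > 0` and `c₃`. -/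
theorem stmt_11 (a b : ℝ) (hab : a < b) (κ : ℝ → ℝ)
    (hκ : ContDiffOn ℝ 2 κ (Set.Ioo a b)) (hκpos : ∀ s ∈ Set.Ioo a b, 0 < κ s) :
    (∀ s ∈ Set.Ioo a b,
        3 * (deriv κ s) ^ 2 - 2 * κ s * deriv (deriv κ) s = 4 * (κ s) ^ 4)
      ↔ ∃ c₂ : ℝ, 0 < c₂ ∧ ∃ c₃ : ℝ, ∀ s ∈ Set.Ioo a b,
          κ s = 4 * c₂ / (16 + (c₂ * s + c₃) ^ 2) := by
  constructor
  · intro h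
    have hκ' : ∀ s ∈ Ioo a b, HasDerivAt κ (deriv κ s) s := fun s hs =>
      ((hκ.differentiableOn (by norm_num)).differentiableAt (isOpen_Ioo.mem_nhds hs)).hasDerivAt
    have hκ'' : ∀ s ∈ Ioo a b, HasDerivAt (deriv κ) (deriv (deriv κ) s) s := fun s hs =>
      (((hκ.deriv_of_isOpen (m := 1) isOpen_Ioo (by norm_num)).differentiableOn
        (by norm_num)).differentiableAt (isOpen_Ioo.mem_nhds hs)).hasDerivAt
    obtain ⟨c, hc⟩ := exists_eq_const_of_hasDerivAt_zero (a := a) (b := b)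
      (fun t => 4 * κ t + deriv κ t ^ 2 / κ t ^ 3) fun s hs => by
        have hne := (hκpos s hs).ne'
        refine (((hκ' s hs).const_mul 4).fun_add
          (((hκ'' s hs).fun_pow 2).fun_div ((hκ' s hs).fun_pow 3) (pow_ne_zero 3 hne))).congr_deriv ?_
        have := h s hs
        field_simp
        push_cast
        linear_combination -(deriv κ s * κ s ^ 2) * this
    obtain ⟨e, he⟩ := exists_eq_const_of_hasDerivAt_zero (a := a) (b := b)
      (fun t => -deriv κ t / κ t ^ 2 - c / 2 * t) fun s hs => by
        have hne := (hκpos s hs).ne'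
        refine (((hκ'' s hs).fun_neg.fun_div ((hκ' s hs).fun_pow 2) (pow_ne_zero 2 hne)).fun_sub
          ((hasDerivAt_id s).const_mul (c / 2))).congr_deriv ?_
        have := h s hs
        rw [← hc s hs]
        field_simp
        push_cast
        linear_combination κ s * this
    obtain ⟨m, hm⟩ := nonempty_Ioo.2 hab
    have hcpos : 0 < c := by
      rw [← hc m hm]
      have := hκpos m hm
      positivity
    refine ⟨c, hcpos, 2 * e, fun s hs => ?_⟩
    have hpos := hκpos s hs
    have hu : c * s + 2 * e = -2 * deriv κ s / κ s ^ 2 := by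
      rw [← he s hs]
      ring
    rw [hu, ← hc s hs]
    field_simp
    ring
  · rintro ⟨c, -, d, h⟩ s hs
    have h' : ∀ t ∈ Ioo a b,
        deriv κ t = -(8 * c ^ 2 * (c * t + d)) / (16 + (c * t + d) ^ 2) ^ 2 := fun t ht =>
      ((hasDerivAt_curvature_profile t).congr_of_eventuallyEq
        (Filter.eventuallyEq_of_mem (isOpen_Ioo.mem_nhds ht) h)).deriv
    have h'' := ((hasDerivAt_deriv_curvature_profile s).congr_of_eventuallyEq
        (Filter.eventuallyEq_of_mem (isOpen_Ioo.mem_nhds hs) h')).deriv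
    rw [h'', h' s hs, h s hs]
    have hD : 16 + (c * s + d) ^ 2 ≠ 0 := by positivity
    field_simp
    ring
end

section
/- Let γ : ℝ → ℝ² be the planar curve γ(s) = (4·ln(√(16 + s²) + s), √(16 + s²)). Then for all s ∈ ℝ: (1) ‖γ'(s)‖ = 1, so s is an arclength parameter; (2) the curvature satisfies ‖γ''(s)‖ = 4/(16 + s²); (3) for f(s) = (16 + s²)^{3/2} one has f(s)·γ''(s) = (−4s, 16), and hence the second derivative of s ↦ f(s)·γ''(s) vanishes identically, so γ is an f-biharmonic curve for this f. -/
/-- A curve in the Euclidean plane is differentiated coordinatewise. -/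
lemma HasDerivAt.euclidean_plane {a b : ℝ → ℝ} {da db s : ℝ}
    (ha : HasDerivAt a da s) (hb : HasDerivAt b db s) :
    HasDerivAt (fun t => (WithLp.equiv 2 (Fin 2 → ℝ)).symm ![a t, b t])
      ((WithLp.equiv 2 (Fin 2 → ℝ)).symm ![da, db]) s := by
  have h : HasDerivAt (fun t => ![a t, b t]) ![da, db] s := by
    rw [hasDerivAt_pi]
    intro i
    fin_cases i
    · exact ha
    · exact hb
  exact (PiLp.continuousLinearEquiv 2 ℝ (fun _ : Fin 2 => ℝ)).symm.hasFDerivAt.comp_hasDerivAt s h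

lemma norm_euclidean_plane (a b : ℝ) :
    ‖((WithLp.equiv 2 (Fin 2 → ℝ)).symm ![a, b] : EuclideanSpace ℝ (Fin 2))‖
      = √(a ^ 2 + b ^ 2) := by
  simp [EuclideanSpace.norm_eq, Fin.sum_univ_two]

lemma sqrt_sixteen_add_sq_pos (s : ℝ) : 0 < √(16 + s ^ 2) :=
  Real.sqrt_pos.2 (by positivity)

lemma sq_sqrt_sixteen_add_sq (s : ℝ) : √(16 + s ^ 2) ^ 2 = 16 + s ^ 2 :=
  Real.sq_sqrt (by positivity)

lemma sqrt_sixteen_add_sq_add_pos (s : ℝ) : 0 < √(16 + s ^ 2) + s := by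
  have h : |s| < √(16 + s ^ 2) := by
    rw [← Real.sqrt_sq_eq_abs]
    exact Real.sqrt_lt_sqrt (sq_nonneg s) (by linarith)
  linarith [neg_abs_le s]

lemma hasDerivAt_sqrt_sixteen_add_sq (s : ℝ) :
    HasDerivAt (fun t : ℝ => √(16 + t ^ 2)) (s / √(16 + s ^ 2)) s := by
  refine (((hasDerivAt_pow 2 s).const_add 16).sqrt (by positivity)).congr_deriv ?_
  field_simp
  norm_num

lemma hasDerivAt_four_mul_log (s : ℝ) :
    HasDerivAt (fun t : ℝ => 4 * Real.log (√(16 + t ^ 2) + t)) (4 / √(16 + s ^ 2)) s := by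
  have hp := sqrt_sixteen_add_sq_add_pos s
  have hw := sqrt_sixteen_add_sq_pos s
  refine ((((hasDerivAt_sqrt_sixteen_add_sq s).add (hasDerivAt_id' s)).log hp.ne').const_mul
    4).congr_deriv ?_
  simp only [Pi.add_apply]
  field_simp
  ring

lemma hasDerivAt_four_div_sqrt (s : ℝ) :
    HasDerivAt (fun t : ℝ => 4 / √(16 + t ^ 2)) (-4 * s / √(16 + s ^ 2) ^ 3) s := by
  have hw := sqrt_sixteen_add_sq_pos s
  refine ((hasDerivAt_const s (4 : ℝ)).div (hasDerivAt_sqrt_sixteen_add_sq s) hw.ne').congr_deriv ?_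
  field_simp
  ring

lemma hasDerivAt_self_div_sqrt (s : ℝ) :
    HasDerivAt (fun t : ℝ => t / √(16 + t ^ 2)) (16 / √(16 + s ^ 2) ^ 3) s := by
  have hw := sqrt_sixteen_add_sq_pos s
  refine ((hasDerivAt_id' s).div (hasDerivAt_sqrt_sixteen_add_sq s) hw.ne').congr_deriv ?_
  have h2 := sq_sqrt_sixteen_add_sq s
  generalize √(16 + s ^ 2) = w at *
  field_simp
  linarith


/-- The planar curve `γ(s) = (4·ln(√(16 + s²) + s), √(16 + s²))` is parametrized by arclength,
has curvature `‖γ''(s)‖ = 4/(16 + s²)`, and for `f(s) = (16 + s²)^{3/2}` one has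
`f(s)·γ''(s) = (−4s, 16)`, whence `(f·γ'')'' = 0`, so `γ` is a proper `f`-biharmonic curve. -/
theorem stmt_13 (γ : ℝ → EuclideanSpace ℝ (Fin 2))
    (hγ : γ = fun s => (WithLp.equiv 2 (Fin 2 → ℝ)).symm
      ![4 * Real.log (Real.sqrt (16 + s ^ 2) + s), Real.sqrt (16 + s ^ 2)])
    (f : ℝ → ℝ) (hf : f = fun s => (16 + s ^ 2) ^ ((3 : ℝ) / 2)) :
    (∀ s : ℝ, ‖deriv γ s‖ = 1) ∧
    (∀ s : ℝ, ‖deriv (deriv γ) s‖ = 4 / (16 + s ^ 2)) ∧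
    (∀ s : ℝ, f s • deriv (deriv γ) s
        = (WithLp.equiv 2 (Fin 2 → ℝ)).symm ![-4 * s, 16]) ∧
    (∀ s : ℝ, deriv (deriv (fun t => f t • deriv (deriv γ) t)) s = 0) := by
  have h1 : deriv γ = fun s => (WithLp.equiv 2 (Fin 2 → ℝ)).symm
      ![4 / √(16 + s ^ 2), s / √(16 + s ^ 2)] := by
    subst hγ
    exact funext fun s =>
      ((hasDerivAt_four_mul_log s).euclidean_plane (hasDerivAt_sqrt_sixteen_add_sq s)).deriv
  have h2 : deriv (deriv γ) = fun s => (WithLp.equiv 2 (Fin 2 → ℝ)).symm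
      ![-4 * s / √(16 + s ^ 2) ^ 3, 16 / √(16 + s ^ 2) ^ 3] := by
    rw [h1]
    exact funext fun s =>
      ((hasDerivAt_four_div_sqrt s).euclidean_plane (hasDerivAt_self_div_sqrt s)).deriv
  have h3 : ∀ s : ℝ, f s • deriv (deriv γ) s
      = (WithLp.equiv 2 (Fin 2 → ℝ)).symm ![-4 * s, 16] := by
    intro s
    have hw := sqrt_sixteen_add_sq_pos s
    have hfs : f s = √(16 + s ^ 2) ^ 3 := by
      rw [hf, Real.sqrt_eq_rpow, ← Real.rpow_mul_natCast (by positivity)]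
      norm_num
    rw [h2, hfs]
    ext i
    fin_cases i
    · simp
      field_simp
    · simp
      field_simp
  refine ⟨fun s => ?_, fun s => ?_, h3, fun s => ?_⟩
  · have hw := sqrt_sixteen_add_sq_pos s
    have hsq := sq_sqrt_sixteen_add_sq s
    rw [h1, norm_euclidean_plane, Real.sqrt_eq_one, div_pow, div_pow, hsq]
    field_simp
    ring
  · have hw := sqrt_sixteen_add_sq_pos s
    have hsq := sq_sqrt_sixteen_add_sq s
    rw [h2, norm_euclidean_plane, Real.sqrt_eq_iff_eq_sq (by positivity) (by positivity)]
    generalize √(16 + s ^ 2) = w at *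
    rw [← hsq]
    field_simp
    linarith
  · have h4 : deriv (fun t => f t • deriv (deriv γ) t)
        = fun _ => (WithLp.equiv 2 (Fin 2 → ℝ)).symm ![-4, 0] := by
      rw [funext h3]
      refine funext fun t => HasDerivAt.deriv (HasDerivAt.euclidean_plane ?_ ?_)
      · exact ((hasDerivAt_id' t).const_mul (-4 : ℝ)).congr_deriv (mul_one _)
      · exact hasDerivAt_const t 16
    rw [h4]
    exact deriv_const s _
end

section
/- Let γ : (−2, 2) → ℝ³ be the curve γ(s) = ((2/3)(1 + s/2)^{3/2}, (2/3)(1 − s/2)^{3/2}, s/√2). Then there exists no twice differentiable function f : (−2, 2) → ℝ with f(s) > 0 for all s ∈ (−2, 2) such that the second derivative of s ↦ f(s)·γ''(s) vanishes identically on (−2, 2); that is, γ is not an f-biharmonic curve for any positive function f. -/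
/-- A `C²` map on an open interval whose second derivative vanishes is affine there. -/
theorem exists_eq_add_smul_of_deriv_deriv_eq_zero {E : Type*} [NormedAddCommGroup E]
    [NormedSpace ℝ E] {G : ℝ → E} {a b : ℝ} (hG : ContDiffOn ℝ 2 G (Set.Ioo a b))
    (h : ∀ s ∈ Set.Ioo a b, deriv (deriv G) s = 0) :
    ∃ A B : E, ∀ s ∈ Set.Ioo a b, G s = A + s • B := by
  have hG' : ContDiffOn ℝ 1 (deriv G) (Set.Ioo a b) :=
    ((contDiffOn_succ_iff_deriv_of_isOpen (n := 1) isOpen_Ioo).1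
      (by simpa [one_add_one_eq_two] using hG)).2.2
  obtain ⟨B, hB⟩ := isOpen_Ioo.exists_is_const_of_deriv_eq_zero isPreconnected_Ioo
    (hG'.differentiableOn (by norm_num)) h
  have hlin (s : ℝ) : HasDerivAt (fun s : ℝ => s • B) B s := by
    simpa using (hasDerivAt_id s).smul_const B
  have hd (s : ℝ) (hs : s ∈ Set.Ioo a b) : HasDerivAt (fun s => G s - s • B) 0 s := by
    have h1 := ((hG.differentiableOn (by norm_num)).differentiableAt
      (isOpen_Ioo.mem_nhds hs)).hasDerivAt
    rw [hB s hs] at h1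
    simpa only [sub_self] using h1.fun_sub (hlin s)
  obtain ⟨A, hA⟩ := isOpen_Ioo.exists_is_const_of_deriv_eq_zero isPreconnected_Ioo
    (fun s hs => (hd s hs).differentiableAt.differentiableWithinAt) (fun s hs => (hd s hs).deriv)
  exact ⟨A, B, fun s hs => by rw [← hA s hs]; abel⟩

theorem hasDerivAt_vec_three {p q r : ℝ → ℝ} {p' q' r' s : ℝ} (hp : HasDerivAt p p' s)
    (hq : HasDerivAt q q' s) (hr : HasDerivAt r r' s) :
    HasDerivAt (fun t => !₂[p t, q t, r t]) !₂[p', q', r'] s := by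
  rw [hasDerivAt_iff_hasFDerivAt, ← hasFDerivWithinAt_univ, hasFDerivWithinAt_euclidean]
  intro i
  fin_cases i
  · simpa using hp.hasFDerivAt.congr_fderiv (by ext; simp)
  · simpa using hq.hasFDerivAt.congr_fderiv (by ext; simp)
  · simpa using hr.hasFDerivAt.congr_fderiv (by ext; simp)

theorem hasDerivAt_const_mul_rpow_one_add {c k x s : ℝ} (hs : 0 < 1 + k * s) :
    HasDerivAt (fun t : ℝ => c * (1 + k * t) ^ x) (c * x * k * (1 + k * s) ^ (x - 1)) s := by
  have h : HasDerivAt (fun t : ℝ => 1 + k * t) k s := by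
    simpa using ((hasDerivAt_id s).const_mul k).const_add 1
  exact ((h.rpow_const (p := x) (Or.inl hs.ne')).const_mul c).congr_deriv (by ring)

theorem one_add_half_mul_pos {s : ℝ} (hs : s ∈ Set.Ioo (-2 : ℝ) 2) :
    0 < 1 + (1 / 2) * s ∧ 0 < 1 + (-1 / 2) * s := by
  constructor <;> linarith [hs.1, hs.2]

/-- The second derivative of the helix on `(-2, 2)`. -/
theorem deriv_deriv_helix {s : ℝ} (hs : s ∈ Set.Ioo (-2 : ℝ) 2) :
    deriv (deriv fun t : ℝ => !₂[(2 / 3) * (1 + (1 / 2) * t) ^ ((3 : ℝ) / 2),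
      (2 / 3) * (1 + (-1 / 2) * t) ^ ((3 : ℝ) / 2), t / √2]) s =
    !₂[1 / 8 * (1 + (1 / 2) * s) ^ (-(1 / 2) : ℝ),
      1 / 8 * (1 + (-1 / 2) * s) ^ (-(1 / 2) : ℝ), 0] := by
  have h1 : Set.EqOn (deriv fun t : ℝ => !₂[(2 / 3) * (1 + (1 / 2) * t) ^ ((3 : ℝ) / 2),
      (2 / 3) * (1 + (-1 / 2) * t) ^ ((3 : ℝ) / 2), t / √2])
      (fun t => !₂[1 / 2 * (1 + (1 / 2) * t) ^ ((1 : ℝ) / 2),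
        -1 / 2 * (1 + (-1 / 2) * t) ^ ((1 : ℝ) / 2), 1 / √2]) (Set.Ioo (-2) 2) := by
    intro t ht
    obtain ⟨hp, hm⟩ := one_add_half_mul_pos ht
    refine ((hasDerivAt_vec_three (hasDerivAt_const_mul_rpow_one_add hp)
      (hasDerivAt_const_mul_rpow_one_add hm) ((hasDerivAt_id t).div_const _)).deriv).trans ?_
    norm_num
  obtain ⟨hp, hm⟩ := one_add_half_mul_pos hs
  rw [(h1.eventuallyEq_of_mem (isOpen_Ioo.mem_nhds hs)).deriv_eq]
  refine ((hasDerivAt_vec_three (hasDerivAt_const_mul_rpow_one_add hp)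
      (hasDerivAt_const_mul_rpow_one_add hm) (hasDerivAt_const _ _)).deriv).trans ?_
  norm_num

/-- If `f / √(1 + s/2)` and `f / √(1 - s/2)` are both affine on `(-2, 2)`, then `f 0 = 0`. -/
theorem eq_zero_of_mul_rpow_affine {f : ℝ → ℝ} {a b c d : ℝ}
    (hab : ∀ s ∈ Set.Ioo (-2 : ℝ) 2,
      f s * (1 / 8 * (1 + (1 / 2) * s) ^ (-(1 / 2) : ℝ)) = a + s * b)
    (hcd : ∀ s ∈ Set.Ioo (-2 : ℝ) 2,
      f s * (1 / 8 * (1 + (-1 / 2) * s) ^ (-(1 / 2) : ℝ)) = c + s * d) :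
    f 0 = 0 := by
  have key (s : ℝ) (hs : s ∈ Set.Ioo (-2 : ℝ) 2) :
      (a + s * b) ^ 2 * (1 + (1 / 2) * s) = (c + s * d) ^ 2 * (1 + (-1 / 2) * s) := by
    have hsq {x : ℝ} (hx : 0 < x) : (x ^ (-(1 / 2) : ℝ)) ^ 2 * x = 1 := by
      rw [← Real.rpow_natCast, ← Real.rpow_mul hx.le, show -(1 / 2 : ℝ) * (2 : ℕ) = -1 by norm_num,
        Real.rpow_neg_one, inv_mul_cancel₀ hx.ne']
    obtain ⟨hp, hm⟩ := one_add_half_mul_pos hs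
    rw [← hab s hs, ← hcd s hs]
    linear_combination (f s ^ 2 / 64) * hsq hp - (f s ^ 2 / 64) * hsq hm
  have k0 := key 0 (by norm_num)
  have k1 := key 1 (by norm_num)
  have k2 := key (-1) (by norm_num)
  have k3 := key (1 / 2) (by norm_num)
  have hbd : b ^ 2 + d ^ 2 = 0 := by linarith
  have hb : b = 0 := by nlinarith [sq_nonneg b, sq_nonneg d]
  have hd : d = 0 := by nlinarith [sq_nonneg b, sq_nonneg d]
  subst hb hd
  have ha : a = 0 := by nlinarith [sq_nonneg a, sq_nonneg c]
  simpa [ha] using hab 0 (by norm_num)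

/-- The general helix `γ(s) = ((2/3)(1 + s/2)^{3/2}, (2/3)(1 − s/2)^{3/2}, s/√2)` on `(−2, 2)`
is not an `f`-biharmonic curve for any positive (twice continuously differentiable) function
`f`: there is no such `f` with `(f·γ'')'' = 0` identically on `(−2, 2)`. -/
theorem stmt_15 (γ : ℝ → EuclideanSpace ℝ (Fin 3))
    (hγ : γ = fun s => (WithLp.equiv 2 (Fin 3 → ℝ)).symm
      ![(2 / 3) * (1 + s / 2) ^ ((3 : ℝ) / 2),
        (2 / 3) * (1 - s / 2) ^ ((3 : ℝ) / 2),
        s / Real.sqrt 2]) :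
    ¬ ∃ f : ℝ → ℝ, ContDiffOn ℝ 2 f (Set.Ioo (-2 : ℝ) 2) ∧
        (∀ s ∈ Set.Ioo (-2 : ℝ) 2, 0 < f s) ∧
        (∀ s ∈ Set.Ioo (-2 : ℝ) 2,
          deriv (deriv (fun t => f t • deriv (deriv γ) t)) s = 0) := by
  rintro ⟨f, hf, hpos, h⟩
  have hγ' : γ = fun t : ℝ => !₂[(2 / 3) * (1 + (1 / 2) * t) ^ ((3 : ℝ) / 2),
      (2 / 3) * (1 + (-1 / 2) * t) ^ ((3 : ℝ) / 2), t / √2] := by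
    rw [hγ]
    funext t
    rw [show 1 + t / 2 = 1 + (1 / 2) * t by ring, show 1 - t / 2 = 1 + (-1 / 2) * t by ring]
    rfl
  have hγ'' (s : ℝ) (hs : s ∈ Set.Ioo (-2 : ℝ) 2) := deriv_deriv_helix hs
  rw [← hγ'] at hγ''
  have hsmooth : ContDiffOn ℝ 2 (deriv (deriv γ)) (Set.Ioo (-2) 2) := by
    refine ContDiffOn.congr ?_ hγ''
    rw [contDiffOn_euclidean]
    have hrpow {k : ℝ} (hk : ∀ s ∈ Set.Ioo (-2 : ℝ) 2, 0 < 1 + k * s) :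
        ContDiffOn ℝ 2 (fun s : ℝ => 1 / 8 * (1 + k * s) ^ (-(1 / 2) : ℝ)) (Set.Ioo (-2) 2) :=
      contDiffOn_const.mul (ContDiffOn.rpow_const_of_ne (by fun_prop) fun s hs => (hk s hs).ne')
    intro i
    fin_cases i
    · exact hrpow fun s hs => (one_add_half_mul_pos hs).1
    · exact hrpow fun s hs => (one_add_half_mul_pos hs).2
    · exact contDiffOn_const
  obtain ⟨A, B, hAB⟩ := exists_eq_add_smul_of_deriv_deriv_eq_zero (hf.smul hsmooth) h
  refine (hpos 0 (by norm_num)).ne' (eq_zero_of_mul_rpow_affine (f := f) (a := A 0) (b := B 0)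
    (c := A 1) (d := B 1) (fun s hs => ?_) fun s hs => ?_)
  · simpa [hγ'' s hs] using congrArg (fun v => v 0) (hAB s hs)
  · simpa [hγ'' s hs] using congrArg (fun v => v 1) (hAB s hs)
end
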